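/- (Rule 4, inductive case.) Let σ₀, …, σ_N be an execution and suppose the value v is decided in register set r at σ_N via a quorum Q ∈ 𝒬 r, where, in case r is client-restricted, every server s with σ_N s r = some (some w) has w = v. Suppose step k writes a non-nil value v' to a register set r' > r, this step satisfies Rule 4 at its pre-state σ_{k-1}, and every non-nil value written by steps before step k to register sets > r equals v. Then v = v'. -/

import Mathlib

/-- `Step σ σ' s r x`: a write-once step from `σ` to `σ'` writing `x` to the
previously unwritten register `r` on server `s`, leaving all else unchanged. -/
def Step {S V : Type*} (σ σ' : S → ℕ → Option (Option V))
    (s : S) (r : ℕ) (x : Option V) : Prop :=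
  σ s r = none ∧ σ' s r = some x ∧
    ∀ (s' : S) (r' : ℕ), ¬(s' = s ∧ r' = r) → σ' s' r' = σ s' r'

/-- `Possible CR σ r Q v`: the value `v` is a possible decision of the quorum
`Q` in register set `r` at state `σ`: every `s ∈ Q` has register `r` unwritten
or containing `v`, and moreover, if `r` is client-restricted (`CR r`), every
server with a non-nil value in register set `r` holds `v` there. -/
def Possible {S V : Type*} (CR : ℕ → Prop)
    (σ : S → ℕ → Option (Option V)) (r : ℕ) (Q : Set S) (v : V) : Prop :=
  (∀ s ∈ Q, σ s r = none ∨ σ s r = some (some v)) ∧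
  (CR r → ∀ (s : S) (w : V), σ s r = some (some w) → w = v)

/-- `Rule4 𝒬 CR σ r v`: a step writing the non-nil value `v` to register set
`r` satisfies Rule 4 at its pre-state `σ`: for every earlier register set
`r' < r`, every quorum `Q ∈ 𝒬 r'` and every value `v' ≠ v`, `v'` is not a
possible decision of `Q` in register set `r'` at `σ`. -/
def Rule4 {S V : Type*} (𝒬 : ℕ → Set (Set S)) (CR : ℕ → Prop)
    (σ : S → ℕ → Option (Option V)) (r : ℕ) (v : V) : Prop :=
  ∀ r' < r, ∀ Q ∈ 𝒬 r', ∀ v' : V, v' ≠ v → ¬ Possible CR σ r' Q v'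

/-- A write-once step preserves the contents of every written register. -/
theorem Step.eq_some_of_eq_some {S V : Type*} {σ σ' : S → ℕ → Option (Option V)}
    {s : S} {r : ℕ} {x : Option V} (h : Step σ σ' s r x) {t : S} {i : ℕ} {y : Option V}
    (hy : σ t i = some y) : σ' t i = some y := by
  obtain ⟨hnone, -, hframe⟩ := h
  rw [hframe t i ?_, hy]
  rintro ⟨rfl, rfl⟩
  simp [hnone] at hy

/-- Along an execution, the contents of a written register persist. -/
theorem eq_some_of_le_of_eq_some {S V : Type*} {N : ℕ} {σ : ℕ → S → ℕ → Option (Option V)}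
    (hstep : ∀ k < N, ∃ (s : S) (r : ℕ) (x : Option V), Step (σ k) (σ (k + 1)) s r x)
    {m n : ℕ} (hmn : m ≤ n) (hnN : n ≤ N) {t : S} {i : ℕ} {y : Option V}
    (hy : σ m t i = some y) : σ n t i = some y := by
  induction n, hmn using Nat.le_induction with
  | base => exact hy
  | succ n _ ih =>
    obtain ⟨s, r, x, h⟩ := hstep n hnN
    exact h.eq_some_of_eq_some (ih (Nat.le_of_succ_le hnN))

/-- A value decided at the end of an execution is a possible decision of the deciding quorum
at every state of the execution. -/
theorem possible_of_decided {S V : Type*} {CR : ℕ → Prop} {N : ℕ}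
    {σ : ℕ → S → ℕ → Option (Option V)}
    (hstep : ∀ k < N, ∃ (s : S) (r : ℕ) (x : Option V), Step (σ k) (σ (k + 1)) s r x)
    {r : ℕ} {Q : Set S} {v : V} (hdec : ∀ s ∈ Q, σ N s r = some (some v))
    (hcr : CR r → ∀ (s : S) (w : V), σ N s r = some (some w) → w = v)
    {m : ℕ} (hm : m ≤ N) : Possible CR (σ m) r Q v := by
  refine ⟨fun s hs => ?_, fun hr s w hw =>
    hcr hr s w (eq_some_of_le_of_eq_some hstep hm le_rfl hw)⟩
  cases hy : σ m s r with
  | none => exact .inl rfl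
  | some y => exact .inr ((eq_some_of_le_of_eq_some hstep hm le_rfl hy).symm.trans (hdec s hs))

/-- **Rule 4, inductive case.**
Let `σ 0, …, σ N` be an execution. Suppose the value `v` is decided in register
set `r` at `σ N` via the quorum `Q ∈ 𝒬 r`, where, in case `r` is
client-restricted, every non-nil value in register set `r` at `σ N` is `v`.
If step `k` (from `σ (k-1)` to `σ k`) writes a non-nil value `v'` to a register
set `r' > r`, satisfies Rule 4 at its pre-state `σ (k-1)`, and every non-nil
value written by earlier steps to register sets `> r` equals `v`, then
`v = v'`. -/
theorem rule4_inductive_case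
    {S V : Type*} [Fintype S]
    (𝒬 : ℕ → Set (Set S)) (CR : ℕ → Prop)
    (N : ℕ) (σ : ℕ → S → ℕ → Option (Option V))
    (h0 : ∀ (s : S) (r : ℕ), σ 0 s r = none)
    (hstep : ∀ k < N, ∃ (s : S) (r : ℕ) (x : Option V), Step (σ k) (σ (k + 1)) s r x)
    (r : ℕ) (Q : Set S) (hQ : Q ∈ 𝒬 r) (v : V)
    (hdec : ∀ s ∈ Q, σ N s r = some (some v))
    (hcr : CR r → ∀ (s : S) (w : V), σ N s r = some (some w) → w = v)
    (k : ℕ) (hk1 : 1 ≤ k) (hkN : k ≤ N)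
    (r' : ℕ) (hrr' : r < r') (v' : V)
    (hwrite : ∃ s : S, Step (σ (k - 1)) (σ k) s r' (some v'))
    (hrule4 : Rule4 𝒬 CR (σ (k - 1)) r' v')
    (hprev : ∀ j, 1 ≤ j → j < k → ∀ (s : S) (i : ℕ) (w : V), r < i →
      Step (σ (j - 1)) (σ j) s i (some w) → w = v) :
    v = v' := by
  by_contra hne
  exact hrule4 r hrr' Q hQ v hne
    (possible_of_decided hstep hdec hcr ((Nat.sub_le k 1).trans hkN))
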